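/- If w ∈ X and w ≠ 0, then no function f : X → [-∞,+∞] satisfies f(x) = f*(−x) + ⟨w, x⟩ for all x ∈ X. In addition, if c ∈ X and c ≠ 0, then no function f : X → [-∞,+∞] satisfies f(x) = f*(−x + c) for all x ∈ X. -/

import Mathlib

open scoped RealInnerProductSpace

/-- The Legendre–Fenchel conjugate of an extended-real-valued function on a real
Hilbert space: `f*(y) = sup_x (⟪y, x⟫ - f x)`. -/
noncomputable def fenchelConj {X : Type*} [NormedAddCommGroup X] [InnerProductSpace ℝ X]
    (f : X → EReal) : X → EReal :=
  fun y => ⨆ x : X, ((⟪y, x⟫ : ℝ) : EReal) - f x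

theorem aux_c {X : Type*} [NormedAddCommGroup X] [InnerProductSpace ℝ X]
    (c : X) (hc : c ≠ 0) (f : X → EReal) (hf : ∀ x : X, f x = fenchelConj f (-x + c)) : False := by
  have k : ∀ x y, ((⟪-x + c, y⟫ : ℝ) : EReal) - f y ≤ f x := by
    intro x y
    rw [hf x]
    exact le_iSup (fun y => ((⟪-x + c, y⟫ : ℝ) : EReal) - f y) y
  have nb : ∀ x, f x ≠ ⊥ := by
    intro x hx
    have := k x x
    rw [hx] at this
    simp at this
  have R : ∀ x (a : ℝ), f x ≤ a ↔ ∀ y (b : ℝ), f y = b → ⟪-x + c, y⟫ - b ≤ a := by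
    intro x a
    constructor
    · intro h y b hb
      have := (k x y).trans h
      rw [hb] at this
      exact_mod_cast this
    · intro h
      rw [hf x]
      refine iSup_le fun y => ?_
      induction hy : f y with
      | bot => exact absurd hy (nb y)
      | top => simp
      | coe b => exact_mod_cast h y b hy
  have E : ∀ x (a : ℝ), f x ≤ a → ∃ b : ℝ, f x = b ∧ b ≤ a := by
    intro x a h
    induction hy : f x with
    | bot => exact absurd hy (nb x)
    | top => rw [hy] at h; simp at h
    | coe b => exact ⟨b, rfl, by rw [hy] at h; exact_mod_cast h⟩
  have ex : ∃ x, ∃ a : ℝ, f x = a := by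
    by_contra hne
    push Not at hne
    have : f 0 ≤ ((0 : ℝ) : EReal) := (R 0 0).2 fun y b hb => absurd hb (hne y b)
    obtain ⟨b, hb, _⟩ := E _ _ this
    exact hne _ _ hb
  have S1 : ∀ x (a : ℝ), f x = a → f (x + c) ≤ ((a - ⟪x, c⟫ : ℝ) : EReal) := by
    intro x a h
    refine (R _ _).2 fun y b hb => ?_
    have := (R y b).1 hb.le x a h
    simp only [inner_add_left, inner_neg_left] at this ⊢
    rw [real_inner_comm x y] at this
    rw [real_inner_comm x c] at *
    linarith
  have S2 : ∀ x (b : ℝ), f (x + c) = b → f x ≤ ((b + ⟪x, c⟫ : ℝ) : EReal) := by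
    intro x b h
    refine (R _ _).2 fun y d hd => ?_
    obtain ⟨e, he, hle⟩ := E _ _ (S1 y d hd)
    have := (R _ _).1 h.le _ _ he
    simp only [inner_add_left, inner_neg_left, inner_add_right] at this ⊢
    rw [real_inner_comm c y] at hle
    linarith
  obtain ⟨x, a, ha⟩ := ex
  obtain ⟨b, hb, hba⟩ := E _ _ (S1 x a ha)
  obtain ⟨d, hd, hdb⟩ := E _ _ (S1 _ b hb)
  obtain ⟨a2, haa, hab⟩ := E _ _ (S2 x b hb)
  have e : a2 = a := by rw [ha] at haa; exact_mod_cast haa.symm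
  have pos : 0 < ⟪c, c⟫ := real_inner_self_pos.2 hc
  have : f (x + c) ≤ ((b - ⟪c, c⟫ / 2 : ℝ) : EReal) := by
    refine (R _ _).2 fun y t ht => ?_
    have h1 := (R _ _).1 ha.le y t ht
    have h2 := (R _ _).1 hd.le y t ht
    simp only [inner_add_left, inner_neg_left] at *
    linarith
  rw [hb] at this
  have : b ≤ b - ⟪c, c⟫ / 2 := by exact_mod_cast this
  linarith

/-- if `w ≠ 0` then no function `f : X → [-∞,∞]` satisfies
`f(x) = f*(-x) + ⟪w, x⟫` for all `x`; and if `c ≠ 0` then no function satisfies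
`f(x) = f*(-x + c)` for all `x`. -/
theorem no_solution_for_E_eq_neg_id
    {X : Type*} [NormedAddCommGroup X] [InnerProductSpace ℝ X] [CompleteSpace X] [Nontrivial X] :
    (∀ w : X, w ≠ 0 → ∀ f : X → EReal,
      ¬ (∀ x : X, f x = fenchelConj f (-x) + ((⟪w, x⟫ : ℝ) : EReal))) ∧
    (∀ c : X, c ≠ 0 → ∀ f : X → EReal,
      ¬ (∀ x : X, f x = fenchelConj f (-x + c))) := by
  constructor
  · intro w hw f hf
    have g : ∀ x, f x - ((⟪w, x⟫ : ℝ) : EReal) = fenchelConj f (-x) := by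
      intro x
      rw [hf x]
      exact EReal.add_sub_cancel_right
    refine aux_c (-w) (neg_ne_zero.2 hw) (fun x => f x - ((⟪w, x⟫ : ℝ) : EReal)) fun x => ?_
    simp only [g x]
    unfold fenchelConj
    refine iSup_congr fun y => ?_
    simp only [inner_add_left, inner_neg_left]
    induction f y with
    | bot => simp
    | top => simp
    | coe b => norm_cast; ring
  · intro c hc f hf
    exact aux_c c hc f hf
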